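/- arXiv:0808.2007 — 11 statements merged into one kernel-verified Lean document; each statement's English description precedes it below -/
import Mathlib

section
/- Let A ∈ M_{n+1}(ℂ) be symmetric, B ∈ ℂ^{n+1}, C ∈ ℂ, and z ∈ ℂ such that R_z := I_{n+1} − zA is invertible. Let S ∈ M_{n+1}(ℂ) be symmetric with S² = R_z and SA = AS, and let c ∈ ℂ^{n+1} satisfy Ac = (S − I)B and (I + S)c = −zB. If x ∈ ℂ^{n+1} satisfies Q(x) := xᵀAx + 2Bᵀx + C = 0, then y := Sx + c satisfies Q_z(y) := yᵀA R_z^{-1} y + 2(R_z^{-1}B)ᵀy + C + z Bᵀ R_z^{-1} B = 0. (The Ivory affinity x ↦ Sx + c maps the quadric Q = 0 onto the confocal quadric Q_z = 0.) -/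
open Matrix

/-- The Ivory affinity `x ↦ Sx + c` maps the quadric `Q = 0` onto the confocal
quadric `Q_z = 0`. -/
theorem ivory_affinity_maps_quadric_to_confocal {n : ℕ}
    (A : Matrix (Fin (n + 1)) (Fin (n + 1)) ℂ) (B : Fin (n + 1) → ℂ) (C z : ℂ)
    (hA : Aᵀ = A)
    (hR : IsUnit (1 - z • A))
    (S : Matrix (Fin (n + 1)) (Fin (n + 1)) ℂ)
    (hSsymm : Sᵀ = S)
    (hS2 : S * S = 1 - z • A)
    (hSA : S * A = A * S)
    (c : Fin (n + 1) → ℂ)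
    (hc1 : A *ᵥ c = (S - 1) *ᵥ B)
    (hc2 : (1 + S) *ᵥ c = -z • B)
    (x : Fin (n + 1) → ℂ)
    (hx : x ⬝ᵥ (A *ᵥ x) + 2 * (B ⬝ᵥ x) + C = 0) :
    (S *ᵥ x + c) ⬝ᵥ ((A * (1 - z • A)⁻¹) *ᵥ (S *ᵥ x + c))
      + 2 * (((1 - z • A)⁻¹ *ᵥ B) ⬝ᵥ (S *ᵥ x + c))
      + C + z * (B ⬝ᵥ ((1 - z • A)⁻¹ *ᵥ B)) = 0 := by
  have hS : IsUnit S := isUnit_of_mul_isUnit_left (hS2 ▸ hR)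
  have hdet : IsUnit S.det := (Matrix.isUnit_iff_isUnit_det S).1 hS
  have hinv : (1 - z • A)⁻¹ = S⁻¹ * S⁻¹ := by rw [← hS2, Matrix.mul_inv_rev]
  have hST : S * S⁻¹ = 1 := Matrix.mul_nonsing_inv S hdet
  have hTS : S⁻¹ * S = 1 := Matrix.nonsing_inv_mul S hdet
  have hTA : S⁻¹ * A = A * S⁻¹ := by
    calc S⁻¹ * A = S⁻¹ * (A * S) * S⁻¹ := by rw [mul_assoc, mul_assoc, hST, mul_one]
      _ = A * S⁻¹ := by rw [← hSA, ← mul_assoc, hTS, one_mul]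
  rw [hinv]
  generalize S⁻¹ = T at *
  obtain ⟨u, rfl⟩ : ∃ u, S *ᵥ u = c := ⟨T *ᵥ c, by rw [mulVec_mulVec, hST, one_mulVec]⟩
  obtain ⟨v, rfl⟩ : ∃ v, S *ᵥ v = B := ⟨T *ᵥ B, by rw [mulVec_mulVec, hST, one_mulVec]⟩
  have hinj : ∀ p q : Fin (n + 1) → ℂ, S *ᵥ p = S *ᵥ q → p = q := fun p q h => by
    simpa [mulVec_mulVec, hTS] using congrArg (T *ᵥ ·) h
  have hadj : ∀ p q : Fin (n + 1) → ℂ, (S *ᵥ p) ⬝ᵥ q = p ⬝ᵥ (S *ᵥ q) := fun p q => by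
    rw [dotProduct_mulVec, ← mulVec_transpose, hSsymm]
  have hAadj : ∀ p q : Fin (n + 1) → ℂ, (A *ᵥ p) ⬝ᵥ q = p ⬝ᵥ (A *ᵥ q) := fun p q => by
    rw [dotProduct_mulVec, ← mulVec_transpose, hA]
  have hAu : A *ᵥ u = S *ᵥ v - v := by
    apply hinj
    rw [mulVec_mulVec, hSA, ← mulVec_mulVec, hc1, sub_mulVec, one_mulVec, mulVec_sub]
  have hu : u + S *ᵥ u = -z • v := by
    apply hinj
    rw [mulVec_add, mulVec_smul, ← hc2, add_mulVec, one_mulVec]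
  have hSTv : ∀ p : Fin (n + 1) → ℂ, S *ᵥ (T *ᵥ p) = p := fun p => by
    rw [mulVec_mulVec, hST, one_mulVec]
  have hTSv : ∀ p : Fin (n + 1) → ℂ, T *ᵥ (S *ᵥ p) = p := fun p => by
    rw [mulVec_mulVec, hTS, one_mulVec]
  have hTAv : ∀ p : Fin (n + 1) → ℂ, A *ᵥ (T *ᵥ p) = T *ᵥ (A *ᵥ p) := fun p => by
    rw [mulVec_mulVec, ← hTA, mulVec_mulVec]
  have hvu : v ⬝ᵥ u + v ⬝ᵥ (S *ᵥ u) = -z * (v ⬝ᵥ v) := by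
    rw [← dotProduct_add, hu, dotProduct_smul, smul_eq_mul]
  have hxu : x ⬝ᵥ (A *ᵥ u) = v ⬝ᵥ (S *ᵥ x) - v ⬝ᵥ x := by
    rw [hAu, dotProduct_sub, dotProduct_comm x, dotProduct_comm x, hadj]
  have huu : u ⬝ᵥ (A *ᵥ u) = v ⬝ᵥ (S *ᵥ u) - v ⬝ᵥ u := by
    rw [hAu, dotProduct_sub, dotProduct_comm u, dotProduct_comm u, hadj]
  have hux : u ⬝ᵥ (A *ᵥ x) = x ⬝ᵥ (A *ᵥ u) := by
    rw [← hAadj, dotProduct_comm]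
  have hquad : (S *ᵥ (x + u)) ⬝ᵥ ((A * (T * T)) *ᵥ (S *ᵥ (x + u)))
      = (x + u) ⬝ᵥ (A *ᵥ (x + u)) := by
    rw [← mulVec_mulVec, ← mulVec_mulVec, hTSv, hTAv, hadj, hSTv]
  have hlin : ((T * T) *ᵥ (S *ᵥ v)) ⬝ᵥ (S *ᵥ (x + u)) = v ⬝ᵥ (x + u) := by
    rw [← mulVec_mulVec, hTSv, ← hadj, hSTv]
  have hconst : (S *ᵥ v) ⬝ᵥ ((T * T) *ᵥ (S *ᵥ v)) = v ⬝ᵥ v := by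
    rw [← mulVec_mulVec, hTSv, hadj, hSTv]
  rw [← mulVec_add, hquad, hlin, hconst]
  rw [hadj] at hx
  simp only [mulVec_add, dotProduct_add, add_dotProduct, hux, hxu, huu]
  linear_combination hx + hvu
end

section
/- (Ivory Theorem: preservation of lengths of segments between confocal quadrics.) Let A ∈ M_{n+1}(ℂ) be symmetric, B ∈ ℂ^{n+1}, C ∈ ℂ, z ∈ ℂ. Let S ∈ M_{n+1}(ℂ) be symmetric with S² = I_{n+1} − zA, and let c ∈ ℂ^{n+1} satisfy (I + S)c = −zB. If x₀, x₁ ∈ ℂ^{n+1} both satisfy Q(x) := xᵀAx + 2Bᵀx + C = 0, then |Sx₁ + c − x₀|² = |Sx₀ + c − x₁|², where |v|² := vᵀv. -/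
open Matrix

/-- The bilinear form of a symmetric matrix is symmetric. -/
theorem dotProduct_mulVec_comm_of_transpose_eq {m R : Type*} [Fintype m] [CommSemiring R]
    {S : Matrix m m R} (hS : Sᵀ = S) (x y : m → R) :
    (S *ᵥ x) ⬝ᵥ y = x ⬝ᵥ (S *ᵥ y) := by
  rw [dotProduct_mulVec, ← mulVec_transpose, hS]

/-- Ivory Theorem: preservation of lengths of segments between confocal quadrics. -/
theorem ivory_theorem {n : ℕ}
    (A : Matrix (Fin (n + 1)) (Fin (n + 1)) ℂ) (B : Fin (n + 1) → ℂ) (C z : ℂ)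
    (hA : Aᵀ = A)
    (S : Matrix (Fin (n + 1)) (Fin (n + 1)) ℂ)
    (hSsymm : Sᵀ = S)
    (hS2 : S * S = 1 - z • A)
    (c : Fin (n + 1) → ℂ)
    (hc : (1 + S) *ᵥ c = -z • B)
    (x₀ x₁ : Fin (n + 1) → ℂ)
    (hx₀ : x₀ ⬝ᵥ (A *ᵥ x₀) + 2 * (B ⬝ᵥ x₀) + C = 0)
    (hx₁ : x₁ ⬝ᵥ (A *ᵥ x₁) + 2 * (B ⬝ᵥ x₁) + C = 0) :
    (S *ᵥ x₁ + c - x₀) ⬝ᵥ (S *ᵥ x₁ + c - x₀)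
      = (S *ᵥ x₀ + c - x₁) ⬝ᵥ (S *ᵥ x₀ + c - x₁) := by
  have hsq (x : Fin (n + 1) → ℂ) :
      (S *ᵥ x) ⬝ᵥ (S *ᵥ x) = x ⬝ᵥ x - z * (x ⬝ᵥ (A *ᵥ x)) := by
    rw [dotProduct_mulVec_comm_of_transpose_eq hSsymm, mulVec_mulVec, hS2, sub_mulVec,
      one_mulVec, smul_mulVec, dotProduct_sub, dotProduct_smul, smul_eq_mul]
  have hlin (x : Fin (n + 1) → ℂ) : (S *ᵥ x) ⬝ᵥ c = -z * (B ⬝ᵥ x) - x ⬝ᵥ c := by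
    have h := congrArg (x ⬝ᵥ ·) hc
    simp only [add_mulVec, one_mulVec, dotProduct_add, dotProduct_smul, smul_eq_mul] at h
    rw [dotProduct_mulVec_comm_of_transpose_eq hSsymm, dotProduct_comm B x]
    linear_combination h
  have hexpand (x y : Fin (n + 1) → ℂ) :
      (S *ᵥ x + c - y) ⬝ᵥ (S *ᵥ x + c - y)
        = x ⬝ᵥ x + y ⬝ᵥ y + c ⬝ᵥ c - z * (x ⬝ᵥ (A *ᵥ x) + 2 * (B ⬝ᵥ x))
          - 2 * (x ⬝ᵥ c) - 2 * (y ⬝ᵥ c) - 2 * ((S *ᵥ x) ⬝ᵥ y) := by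
    simp only [add_dotProduct, sub_dotProduct, dotProduct_add, dotProduct_sub]
    rw [dotProduct_comm c (S *ᵥ x), dotProduct_comm y (S *ᵥ x), dotProduct_comm c y]
    linear_combination hsq x + 2 * hlin x
  have hcross : (S *ᵥ x₁) ⬝ᵥ x₀ = (S *ᵥ x₀) ⬝ᵥ x₁ := by
    rw [dotProduct_mulVec_comm_of_transpose_eq hSsymm, dotProduct_comm]
  rw [hexpand, hexpand]
  linear_combination z * hx₀ - z * hx₁ - 2 * hcross
end

section
/- (Symmetry of the tangency configuration.) Let A ∈ M_{n+1}(ℂ) be symmetric, B ∈ ℂ^{n+1}, C ∈ ℂ. Let S ∈ M_{n+1}(ℂ) be symmetric with SA = AS, and let c ∈ ℂ^{n+1} satisfy Ac = (S − I)B. If x₀, x₁ ∈ ℂ^{n+1} both satisfy Q(x) := xᵀAx + 2Bᵀx + C = 0, then (Sx₁ + c − x₀)ᵀ(Ax₀ + B) = (Sx₀ + c − x₁)ᵀ(Ax₁ + B); that is, the segment from x₀ to the Ivory image of x₁ makes the same bilinear product with the normal direction at x₀ as the segment from x₁ to the Ivory image of x₀ makes with the normal direction at x₁. -/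
open Matrix

theorem Matrix.IsSymm.mulVec_dotProduct {m R : Type*} [Fintype m] [CommSemiring R]
    {M : Matrix m m R} (hM : M.IsSymm) (v w : m → R) : (M *ᵥ v) ⬝ᵥ w = v ⬝ᵥ (M *ᵥ w) := by
  rw [dotProduct_mulVec, ← mulVec_transpose, hM.eq]

/-- Symmetry of the tangency configuration. -/
theorem tangency_configuration_symmetry {n : ℕ}
    (A : Matrix (Fin (n + 1)) (Fin (n + 1)) ℂ) (B : Fin (n + 1) → ℂ) (C : ℂ)
    (hA : Aᵀ = A)
    (S : Matrix (Fin (n + 1)) (Fin (n + 1)) ℂ)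
    (hSsymm : Sᵀ = S)
    (hSA : S * A = A * S)
    (c : Fin (n + 1) → ℂ)
    (hc : A *ᵥ c = (S - 1) *ᵥ B)
    (x₀ x₁ : Fin (n + 1) → ℂ)
    (hx₀ : x₀ ⬝ᵥ (A *ᵥ x₀) + 2 * (B ⬝ᵥ x₀) + C = 0)
    (hx₁ : x₁ ⬝ᵥ (A *ᵥ x₁) + 2 * (B ⬝ᵥ x₁) + C = 0) :
    (S *ᵥ x₁ + c - x₀) ⬝ᵥ (A *ᵥ x₀ + B)
      = (S *ᵥ x₀ + c - x₁) ⬝ᵥ (A *ᵥ x₁ + B) := by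
  have hcA (x : Fin (n + 1) → ℂ) : c ⬝ᵥ (A *ᵥ x) = B ⬝ᵥ (S *ᵥ x) - B ⬝ᵥ x := by
    rw [← IsSymm.mulVec_dotProduct hA, hc, sub_mulVec, one_mulVec, sub_dotProduct,
      IsSymm.mulVec_dotProduct hSsymm]
  have hSB (x : Fin (n + 1) → ℂ) : (S *ᵥ x) ⬝ᵥ B = B ⬝ᵥ (S *ᵥ x) := dotProduct_comm _ _
  have hxB (x : Fin (n + 1) → ℂ) : x ⬝ᵥ B = B ⬝ᵥ x := dotProduct_comm _ _
  have hSAx : (S *ᵥ x₁) ⬝ᵥ (A *ᵥ x₀) = (S *ᵥ x₀) ⬝ᵥ (A *ᵥ x₁) := by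
    rw [IsSymm.mulVec_dotProduct hSsymm, mulVec_mulVec, hSA, ← mulVec_mulVec,
      ← IsSymm.mulVec_dotProduct hA, dotProduct_comm]
  simp only [add_dotProduct, sub_dotProduct, dotProduct_add, hcA, hSB, hxB x₀, hxB x₁, hSAx]
  linear_combination hx₁ - hx₀
end

section
/- (Preservation of angles between segments and rulings under the Ivory affinity.) Let A ∈ M_{n+1}(ℂ), B ∈ ℂ^{n+1}, z ∈ ℂ. Let S ∈ M_{n+1}(ℂ) be symmetric with S² = I_{n+1} − zA, and let c ∈ ℂ^{n+1} satisfy (I + S)c = −zB. Then for all x₀, x₁, w ∈ ℂ^{n+1}: (Sx₁ + c − x₀)ᵀw + (Sx₀ + c − x₁)ᵀ(Sw) = −z·(Ax₀ + B)ᵀw. In particular, if w is tangent to the quadric at x₀, i.e. (Ax₀ + B)ᵀw = 0, then (Sx₁ + c − x₀)ᵀw = −(Sx₀ + c − x₁)ᵀ(Sw). -/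
open Matrix

/-- Preservation of angles between segments and rulings under the Ivory affinity. -/
theorem ivory_preserves_segment_ruling_angles {n : ℕ}
    (A : Matrix (Fin (n + 1)) (Fin (n + 1)) ℂ) (B : Fin (n + 1) → ℂ) (z : ℂ)
    (S : Matrix (Fin (n + 1)) (Fin (n + 1)) ℂ)
    (hSsymm : Sᵀ = S)
    (hS2 : S * S = 1 - z • A)
    (c : Fin (n + 1) → ℂ)
    (hc : (1 + S) *ᵥ c = -z • B) :
    (∀ x₀ x₁ w : Fin (n + 1) → ℂ,
      (S *ᵥ x₁ + c - x₀) ⬝ᵥ w + (S *ᵥ x₀ + c - x₁) ⬝ᵥ (S *ᵥ w)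
        = -z * ((A *ᵥ x₀ + B) ⬝ᵥ w)) ∧
    (∀ x₀ x₁ w : Fin (n + 1) → ℂ, (A *ᵥ x₀ + B) ⬝ᵥ w = 0 →
      (S *ᵥ x₁ + c - x₀) ⬝ᵥ w = -((S *ᵥ x₀ + c - x₁) ⬝ᵥ (S *ᵥ w))) := by
  have adjoint : ∀ u w : Fin (n + 1) → ℂ, u ⬝ᵥ (S *ᵥ w) = (S *ᵥ u) ⬝ᵥ w := fun u w => by
    rw [dotProduct_mulVec, ← mulVec_transpose, hSsymm]
  have key : ∀ x₀ x₁ w : Fin (n + 1) → ℂ,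
      (S *ᵥ x₁ + c - x₀) ⬝ᵥ w + (S *ᵥ x₀ + c - x₁) ⬝ᵥ (S *ᵥ w)
        = -z * ((A *ᵥ x₀ + B) ⬝ᵥ w) := by
    intro x₀ x₁ w
    have hSc : S *ᵥ c = -z • B - c := by
      rw [← hc, add_mulVec, one_mulVec, add_sub_cancel_left]
    have hSS : S *ᵥ (S *ᵥ x₀) = x₀ - z • (A *ᵥ x₀) := by
      rw [mulVec_mulVec, hS2, sub_mulVec, one_mulVec, smul_mulVec]
    rw [adjoint, ← add_dotProduct, ← smul_eq_mul, ← smul_dotProduct, mulVec_sub, mulVec_add,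
      hSc, hSS]
    congr 1
    module
  refine ⟨key, fun x₀ x₁ w hw => eq_neg_of_add_eq_zero_left ?_⟩
  rw [key, hw, mul_zero]
end

section
/- Let A ∈ M_{n+1}(ℂ) be symmetric, B ∈ ℂ^{n+1}, C ∈ ℂ, and z₁, z₂ ∈ ℂ such that R_{z₁} := I − z₁A and R_{z₂} := I − z₂A are invertible. Then for every x ∈ ℂ^{n+1}: Q_{z₁}(x) − Q_{z₂}(x) = (z₁ − z₂)·(R_{z₁}^{-1}(Ax + B))ᵀ(R_{z₂}^{-1}(Ax + B)). Consequently (Lamé), if z₁ ≠ z₂ and x lies on both confocal quadrics, i.e. Q_{z₁}(x) = Q_{z₂}(x) = 0, then the normal directions N̂_{z_i} := R_{z_i}^{-1}(Ax + B) satisfy N̂_{z₁}ᵀN̂_{z₂} = 0: two confocal quadrics cut each other orthogonally. -/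
open Matrix

/-- A matrix moves across the dot product as its transpose. -/
theorem mulVec_dotProduct_eq_dotProduct_transpose_mulVec {ι R : Type*} [Fintype ι] [CommRing R]
    (M : Matrix ι ι R) (u v : ι → R) : (M *ᵥ u) ⬝ᵥ v = u ⬝ᵥ (Mᵀ *ᵥ v) := by
  rw [dotProduct_mulVec, vecMul_transpose]

section Resolvent

variable {ι R : Type*} [Fintype ι] [DecidableEq ι] [CommRing R] {A : Matrix ι ι R} {z w : R}

theorem transpose_inv_one_sub_smul (hA : Aᵀ = A) (z : R) :
    ((1 - z • A)⁻¹)ᵀ = (1 - z • A)⁻¹ := by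
  rw [transpose_nonsing_inv, transpose_sub, transpose_one, transpose_smul, hA]

theorem commute_inv_one_sub_smul {M : Matrix ι ι R} (hM : Commute M A)
    (h : IsUnit (1 - z • A)) : Commute M (1 - z • A)⁻¹ := by
  obtain ⟨u, hu⟩ := h
  rw [← hu, ← coe_units_inv]
  refine Commute.units_inv_right ?_
  rw [hu]
  exact (Commute.one_right M).sub_right (hM.smul_right z)

theorem smul_inv_one_sub_smul_sub (hz : IsUnit (1 - z • A)) (hw : IsUnit (1 - w • A)) :
    z • (1 - z • A)⁻¹ - w • (1 - w • A)⁻¹ = (z - w) • ((1 - z • A)⁻¹ * (1 - w • A)⁻¹) := by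
  have hz' := nonsing_inv_mul _ ((isUnit_iff_isUnit_det _).1 hz)
  have hw' := mul_nonsing_inv _ ((isUnit_iff_isUnit_det _).1 hw)
  generalize (1 - z • A)⁻¹ = P at *
  generalize (1 - w • A)⁻¹ = Q at *
  calc z • P - w • Q
      = z • (P * ((1 - w • A) * Q)) - w • (P * (1 - z • A) * Q) := by
        rw [hz', hw', mul_one, one_mul]
    _ = (z - w) • (P * Q) := by
        simp only [mul_sub, sub_mul, mul_one, one_mul, mul_smul_comm, smul_mul_assoc, mul_assoc]
        module

/-- The resolvent identity. -/
theorem inv_one_sub_smul_sub_inv (hz : IsUnit (1 - z • A)) (hw : IsUnit (1 - w • A)) :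
    (1 - z • A)⁻¹ - (1 - w • A)⁻¹ = (z - w) • ((1 - z • A)⁻¹ * (1 - w • A)⁻¹ * A) := by
  have hz' := nonsing_inv_mul _ ((isUnit_iff_isUnit_det _).1 hz)
  have hw' := mul_nonsing_inv _ ((isUnit_iff_isUnit_det _).1 hw)
  have hc := (commute_inv_one_sub_smul (.refl A) hw).eq
  generalize (1 - z • A)⁻¹ = P at *
  generalize (1 - w • A)⁻¹ = Q at *
  calc P - Q = P * ((1 - w • A) * Q) - P * (1 - z • A) * Q := by
        rw [hz', hw', mul_one, one_mul]
    _ = (z - w) • (P * Q * A) := by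
        rw [mul_assoc P Q A, ← hc]
        simp only [mul_sub, sub_mul, mul_one, one_mul, mul_smul_comm, smul_mul_assoc, mul_assoc]
        module

/-- The difference of two members of a confocal family of quadratic functions is a multiple of
the dot product of the two normals. -/
theorem confocal_sub_eq_mul_dotProduct_normals (hA : Aᵀ = A)
    (hz : IsUnit (1 - z • A)) (hw : IsUnit (1 - w • A)) (B : ι → R) (C : R) (x : ι → R) :
    (x ⬝ᵥ ((A * (1 - z • A)⁻¹) *ᵥ x) + 2 * (((1 - z • A)⁻¹ *ᵥ B) ⬝ᵥ x)
        + C + z * (B ⬝ᵥ ((1 - z • A)⁻¹ *ᵥ B)))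
      - (x ⬝ᵥ ((A * (1 - w • A)⁻¹) *ᵥ x) + 2 * (((1 - w • A)⁻¹ *ᵥ B) ⬝ᵥ x)
        + C + w * (B ⬝ᵥ ((1 - w • A)⁻¹ *ᵥ B)))
      = (z - w) * (((1 - z • A)⁻¹ *ᵥ (A *ᵥ x + B)) ⬝ᵥ ((1 - w • A)⁻¹ *ᵥ (A *ᵥ x + B))) := by
  have hP := transpose_inv_one_sub_smul hA z
  have hQ := transpose_inv_one_sub_smul hA w
  have hlin := inv_one_sub_smul_sub_inv hz hw
  have hconst := smul_inv_one_sub_smul_sub hz hw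
  have hcomm := (commute_inv_one_sub_smul (commute_inv_one_sub_smul (.refl A) hz).symm hw).eq
  generalize (1 - z • A)⁻¹ = P at *
  generalize (1 - w • A)⁻¹ = Q at *
  have quad : x ⬝ᵥ ((A * P) *ᵥ x) - x ⬝ᵥ ((A * Q) *ᵥ x)
      = (z - w) * ((A *ᵥ x) ⬝ᵥ ((P * Q) *ᵥ (A *ᵥ x))) := by
    rw [mulVec_dotProduct_eq_dotProduct_transpose_mulVec, hA, mulVec_mulVec, mulVec_mulVec,
      ← dotProduct_sub, ← sub_mulVec, ← mul_sub, hlin, mul_smul_comm, smul_mulVec,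
      dotProduct_smul, smul_eq_mul, mul_assoc A]
  have lin : (P *ᵥ B) ⬝ᵥ x - (Q *ᵥ B) ⬝ᵥ x = (z - w) * (B ⬝ᵥ ((P * Q) *ᵥ (A *ᵥ x))) := by
    rw [mulVec_dotProduct_eq_dotProduct_transpose_mulVec, hP,
      mulVec_dotProduct_eq_dotProduct_transpose_mulVec, hQ, mulVec_mulVec,
      ← dotProduct_sub, ← sub_mulVec, hlin, smul_mulVec, dotProduct_smul, smul_eq_mul]
  have const : z * (B ⬝ᵥ (P *ᵥ B)) - w * (B ⬝ᵥ (Q *ᵥ B)) = (z - w) * (B ⬝ᵥ ((P * Q) *ᵥ B)) := by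
    simpa only [sub_mulVec, smul_mulVec, dotProduct_sub, dotProduct_smul, smul_eq_mul]
      using congrArg (fun M => B ⬝ᵥ (M *ᵥ B)) hconst
  have hPQ : (P * Q)ᵀ = P * Q := by
    rw [transpose_mul, hP, hQ, hcomm]
  have cross : (A *ᵥ x) ⬝ᵥ ((P * Q) *ᵥ B) = B ⬝ᵥ ((P * Q) *ᵥ (A *ᵥ x)) := by
    rw [dotProduct_comm, mulVec_dotProduct_eq_dotProduct_transpose_mulVec, hPQ]
  rw [mulVec_dotProduct_eq_dotProduct_transpose_mulVec P (A *ᵥ x + B), hP,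
    mulVec_mulVec (A *ᵥ x + B), mulVec_add, add_dotProduct, dotProduct_add, dotProduct_add, cross]
  linear_combination quad + 2 * lin + const

end Resolvent

/-- Difference of confocal quadratic functions, and Lamé's theorem: two confocal
quadrics cut each other orthogonally. -/
theorem confocal_quadrics_orthogonal {n : ℕ}
    (A : Matrix (Fin (n + 1)) (Fin (n + 1)) ℂ) (B : Fin (n + 1) → ℂ) (C : ℂ)
    (z₁ z₂ : ℂ)
    (hA : Aᵀ = A)
    (h₁ : IsUnit (1 - z₁ • A))
    (h₂ : IsUnit (1 - z₂ • A)) :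
    (∀ x : Fin (n + 1) → ℂ,
      (x ⬝ᵥ ((A * (1 - z₁ • A)⁻¹) *ᵥ x) + 2 * (((1 - z₁ • A)⁻¹ *ᵥ B) ⬝ᵥ x)
          + C + z₁ * (B ⬝ᵥ ((1 - z₁ • A)⁻¹ *ᵥ B)))
        - (x ⬝ᵥ ((A * (1 - z₂ • A)⁻¹) *ᵥ x) + 2 * (((1 - z₂ • A)⁻¹ *ᵥ B) ⬝ᵥ x)
          + C + z₂ * (B ⬝ᵥ ((1 - z₂ • A)⁻¹ *ᵥ B)))
        = (z₁ - z₂) * (((1 - z₁ • A)⁻¹ *ᵥ (A *ᵥ x + B)) ⬝ᵥ ((1 - z₂ • A)⁻¹ *ᵥ (A *ᵥ x + B)))) ∧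
    (∀ x : Fin (n + 1) → ℂ, z₁ ≠ z₂ →
      x ⬝ᵥ ((A * (1 - z₁ • A)⁻¹) *ᵥ x) + 2 * (((1 - z₁ • A)⁻¹ *ᵥ B) ⬝ᵥ x)
          + C + z₁ * (B ⬝ᵥ ((1 - z₁ • A)⁻¹ *ᵥ B)) = 0 →
      x ⬝ᵥ ((A * (1 - z₂ • A)⁻¹) *ᵥ x) + 2 * (((1 - z₂ • A)⁻¹ *ᵥ B) ⬝ᵥ x)
          + C + z₂ * (B ⬝ᵥ ((1 - z₂ • A)⁻¹ *ᵥ B)) = 0 →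
      ((1 - z₁ • A)⁻¹ *ᵥ (A *ᵥ x + B)) ⬝ᵥ ((1 - z₂ • A)⁻¹ *ᵥ (A *ᵥ x + B)) = 0) := by
  refine ⟨fun x => confocal_sub_eq_mul_dotProduct_normals hA h₁ h₂ B C x, fun x hne hx₁ hx₂ => ?_⟩
  have h := confocal_sub_eq_mul_dotProduct_normals hA h₁ h₂ B C x
  rw [hx₁, hx₂, sub_zero] at h
  exact (mul_eq_zero.1 h.symm).resolve_left (sub_ne_zero.2 hne)
end

section
/- Let A ∈ M_{n+1}(ℂ), B ∈ ℂ^{n+1}, and let U ⊆ ℂ be an open preconnected set containing 0. Let S : U → M_{n+1}(ℂ) be complex differentiable with S(0) = I_{n+1}, S(z)² = I_{n+1} − zA and S(z) invertible for all z ∈ U, and suppose S'(z) commutes with S(z) for all z ∈ U. Let C : U → ℂ^{n+1} be complex differentiable with C(0) = 0 and C'(z) = −(1/2)·S(z)^{-1}B for all z ∈ U. Then for all z ∈ U: A·C(z) + (I − S(z))B = 0 and (I + S(z))·C(z) + zB = 0. -/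
open Matrix

/-- Product rule for a matrix-vector product, with entrywise derivatives. -/
theorem Matrix.hasDerivAt_mulVec_apply {m l : Type*} [Fintype l]
    {M : ℂ → Matrix m l ℂ} {M' : Matrix m l ℂ} {v : ℂ → l → ℂ} {v' : l → ℂ} {z : ℂ} (i : m)
    (hM : ∀ j, HasDerivAt (fun w => M w i j) (M' i j) z)
    (hv : ∀ j, HasDerivAt (fun w => v w j) (v' j) z) :
    HasDerivAt (fun w => (M w *ᵥ v w) i) ((M' *ᵥ v z + M z *ᵥ v') i) z := by
  simp only [Matrix.mulVec, dotProduct, Pi.add_apply, ← Finset.sum_add_distrib]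
  exact HasDerivAt.fun_sum fun j _ => (hM j).mul (hv j)

/-- The derivative of a family of square roots of `1 - z • A`. -/
theorem Matrix.deriv_mul_add_mul_deriv_eq_neg {m : Type*} [Fintype m] [DecidableEq m]
    {A : Matrix m m ℂ} {S : ℂ → Matrix m m ℂ} {S' : Matrix m m ℂ} {z : ℂ}
    (hS : ∀ i j, HasDerivAt (fun w => S w i j) (S' i j) z)
    (hS2 : ∀ᶠ w in nhds z, S w * S w = 1 - w • A) :
    S' * S z + S z * S' = -A := by
  ext i j
  have h₁ := Matrix.hasDerivAt_mulVec_apply (v := fun w k => S w k j) i (hS i)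
    (fun k => hS k j)
  have h₂ : HasDerivAt (fun w : ℂ => (1 : Matrix m m ℂ) i j - w * A i j) (-A i j) z := by
    simpa using ((hasDerivAt_id z).mul_const (A i j)).const_sub ((1 : Matrix m m ℂ) i j)
  refine h₁.unique (h₂.congr_of_eventuallyEq ?_)
  filter_upwards [hS2] with w hw
  simpa [Matrix.mul_apply, Matrix.mulVec, dotProduct] using congrFun (congrFun hw i) j

/-- A vector-valued function with zero derivative on an open preconnected set vanishes there as
soon as it vanishes at one point. -/
theorem IsPreconnected.eq_zero_of_hasDerivAt_zero {m : Type*} {U : Set ℂ} (hUc : IsPreconnected U)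
    (hUo : IsOpen U) {F : ℂ → m → ℂ} {a : ℂ} (ha : a ∈ U) (hFa : F a = 0)
    (hF : ∀ z ∈ U, ∀ i, HasDerivAt (fun w => F w i) 0 z) {z : ℂ} (hz : z ∈ U) : F z = 0 := by
  ext i
  have h := hUo.is_const_of_deriv_eq_zero hUc (f := fun w => F w i)
    (fun w hw => (hF w hw i).differentiableAt.differentiableWithinAt)
    (fun w hw => (hF w hw i).deriv) hz ha
  simpa [hFa] using h

/-- The Ivory translation vector `C(z)` (the primitive of `−(1/2)·√(R_z)⁻¹·B`
vanishing at `0`) satisfies `A·C(z) + (I − √(R_z))B = 0` and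
`(I + √(R_z))·C(z) + zB = 0` on an open preconnected set containing `0`. -/
theorem ivory_translation_identities {n : ℕ}
    (A : Matrix (Fin (n + 1)) (Fin (n + 1)) ℂ) (B : Fin (n + 1) → ℂ)
    (U : Set ℂ) (hUo : IsOpen U) (hUc : IsPreconnected U) (hU0 : (0 : ℂ) ∈ U)
    (S S' : ℂ → Matrix (Fin (n + 1)) (Fin (n + 1)) ℂ)
    (hS0 : S 0 = 1)
    (hSderiv : ∀ z ∈ U, ∀ i j, HasDerivAt (fun w : ℂ => S w i j) (S' z i j) z)
    (hS2 : ∀ z ∈ U, S z * S z = 1 - z • A)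
    (hSunit : ∀ z ∈ U, IsUnit (S z))
    (hScomm : ∀ z ∈ U, S' z * S z = S z * S' z)
    (c : ℂ → Fin (n + 1) → ℂ)
    (hc0 : c 0 = 0)
    (hcderiv : ∀ z ∈ U, ∀ i,
      HasDerivAt (fun w : ℂ => c w i) ((-(1 / 2 : ℂ) • ((S z)⁻¹ *ᵥ B)) i) z) :
    ∀ z ∈ U, A *ᵥ c z + (1 - S z) *ᵥ B = 0 ∧ (1 + S z) *ᵥ c z + z • B = 0 := by
  have hdet : ∀ z ∈ U, IsUnit (S z).det := fun z hz => (isUnit_iff_isUnit_det _).1 (hSunit z hz)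
  have hsum : ∀ z ∈ U, S' z * S z + S z * S' z = -A := fun z hz =>
    deriv_mul_add_mul_deriv_eq_neg (hSderiv z hz)
      (Filter.mem_of_superset (hUo.mem_nhds hz) hS2)
  have hright : ∀ z ∈ U, S' z * S z = -(1 / 2 : ℂ) • A := fun z hz => by
    have h := hsum z hz
    rw [← hScomm z hz, ← two_smul ℂ] at h
    rw [neg_smul, ← smul_neg, ← h, smul_smul]
    norm_num
  have hS'right : ∀ z ∈ U, S' z = -(1 / 2 : ℂ) • (A * (S z)⁻¹) := fun z hz => by
    rw [← smul_mul_assoc, ← hright z hz, mul_nonsing_inv_cancel_right _ _ (hdet z hz)]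
  have hS'left : ∀ z ∈ U, S' z = -(1 / 2 : ℂ) • ((S z)⁻¹ * A) := fun z hz => by
    rw [← mul_smul_comm, ← hright z hz, hScomm z hz, nonsing_inv_mul_cancel_left _ _ (hdet z hz)]
  have hfirst : ∀ z ∈ U, A *ᵥ c z + (1 - S z) *ᵥ B = 0 := by
    refine fun z => hUc.eq_zero_of_hasDerivAt_zero (F := fun z => A *ᵥ c z + (1 - S z) *ᵥ B)
      hUo hU0 (by simp [hc0, hS0]) fun z hz i => ?_
    have h₁ := hasDerivAt_mulVec_apply (M := fun _ => A) (M' := 0) i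
      (fun j => hasDerivAt_const z (A i j)) (hcderiv z hz)
    have h₂ := hasDerivAt_mulVec_apply (M := fun w => 1 - S w) (M' := -S' z) (v := fun _ => B)
      (v' := 0) i (fun j => (hSderiv z hz i j).const_sub _) (fun j => hasDerivAt_const z (B j))
    refine (h₁.add h₂).congr_deriv ?_
    rw [← Pi.add_apply, hS'right z hz]
    refine congrFun (g := (0 : Fin (n + 1) → ℂ)) ?_ i
    simp [mulVec_smul, smul_mulVec, mulVec_neg]
  refine fun z hz => ⟨hfirst z hz, ?_⟩
  refine hUc.eq_zero_of_hasDerivAt_zero (F := fun z => (1 + S z) *ᵥ c z + z • B) hUo hU0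
    (by simp [hc0]) (fun z hz i => ?_) hz
  have h₁ := hasDerivAt_mulVec_apply (M := fun w => 1 + S w) i
    (fun j => (hSderiv z hz i j).const_add _) (hcderiv z hz)
  have h₂ : HasDerivAt (fun w : ℂ => (w • B) i) (B i) z := by
    simpa using (hasDerivAt_id z).mul_const (B i)
  refine (h₁.add h₂).congr_deriv ?_
  rw [← Pi.add_apply]
  refine congrFun (g := (0 : Fin (n + 1) → ℂ)) ?_ i
  have hAc : A *ᵥ c z = S z *ᵥ B - B := by
    rw [eq_neg_of_add_eq_zero_left (hfirst z hz), sub_mulVec, one_mulVec, neg_sub]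
  rw [hS'left z hz, smul_mulVec, ← mulVec_mulVec, hAc, mulVec_sub, mulVec_smul, add_mulVec,
    one_mulVec, mulVec_mulVec, mulVec_mulVec, nonsing_inv_mul _ (hdet z hz),
    mul_nonsing_inv _ (hdet z hz), one_mulVec]
  module
end

section
/- Let A ∈ M_{n+1}(ℂ) be symmetric, z ∈ ℂ, and let S ∈ M_{n+1}(ℂ) be symmetric with SA = AS. Let B ∈ ℂ^{n+1} be isotropic, i.e. BᵀB = 0, and let c ∈ ℂ^{n+1} satisfy Ac = (S − I)B and (I + S)c = −zB. Then cᵀAc + 2Bᵀc = 0. (For an isotropic quadric without center this says that the translation vector C(z) of the Ivory affinity, transported by the normalizing linear map L, lies itself on the equilateral paraboloid: |I_{1,n}L^{-1}C(z)|² = 2e_{n+1}ᵀL^{-1}C(z).) -/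
open Matrix

/-- For an isotropic quadric without center, the Ivory translation vector lies
itself on the quadric: `cᵀAc + 2Bᵀc = 0`. -/
theorem ivory_translation_on_isotropic_quadric {n : ℕ}
    (A : Matrix (Fin (n + 1)) (Fin (n + 1)) ℂ) (z : ℂ)
    (hA : Aᵀ = A)
    (S : Matrix (Fin (n + 1)) (Fin (n + 1)) ℂ)
    (hSsymm : Sᵀ = S)
    (hSA : S * A = A * S)
    (B : Fin (n + 1) → ℂ)
    (hB : B ⬝ᵥ B = 0)
    (c : Fin (n + 1) → ℂ)
    (hc1 : A *ᵥ c = (S - 1) *ᵥ B)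
    (hc2 : (1 + S) *ᵥ c = -z • B) :
    c ⬝ᵥ (A *ᵥ c) + 2 * (B ⬝ᵥ c) = 0 := by
  have hS : c ⬝ᵥ (S *ᵥ B) = (S *ᵥ c) ⬝ᵥ B := by
    rw [dotProduct_mulVec, ← mulVec_transpose, hSsymm]
  have hcB : c ⬝ᵥ B + (S *ᵥ c) ⬝ᵥ B = 0 := by
    rw [← add_dotProduct, ← one_mulVec c, mulVec_mulVec, mul_one, ← add_mulVec, hc2,
      smul_dotProduct, hB, smul_zero]
  rw [hc1, sub_mulVec, one_mulVec, dotProduct_sub, hS, dotProduct_comm B c]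
  linear_combination hcB
end

section
/- Let A ∈ M_{n+1}(ℂ) be symmetric, and let f₁, f̄₁ ∈ ℂ^{n+1} satisfy f₁ᵀf₁ = 0, f̄₁ᵀf̄₁ = 0, f₁ᵀf̄₁ = 1, and Af₁ = 0. Set B := −f̄₁. Let L ∈ M_{n+1}(ℂ) be invertible with Lᵀ(A + f̄₁f̄₁ᵀ)L = I_{n+1} and L·e_{n+1} = f₁. Let S ∈ M_{n+1}(ℂ) be symmetric with SA = AS and S·f₁ = f₁, and let c ∈ ℂ^{n+1} satisfy Ac = (S − I)B. Then e_{n+1}ᵀ·L^{-1}·S·L = (−I_{1,n}·L^{-1}c + e_{n+1})ᵀ, where I_{1,n} := I_{n+1} − e_{n+1}e_{n+1}ᵀ. (For an isotropic quadric without center, with S = √(R_z) and c = C(z), this identifies the last row of L^{-1}√(R_z)L in terms of the Ivory translation vector.) -/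
open Matrix

/-- For an isotropic quadric without center, the last row of `L⁻¹·√(R_z)·L` is
determined by the Ivory translation vector:
`e_{n+1}ᵀ L⁻¹ S L = (−I_{1,n} L⁻¹ c + e_{n+1})ᵀ`. -/
theorem last_row_of_conjugated_sqrt {n : ℕ}
    (A : Matrix (Fin (n + 1)) (Fin (n + 1)) ℂ)
    (hA : Aᵀ = A)
    (f₁ fbar₁ : Fin (n + 1) → ℂ)
    (hf₁ : f₁ ⬝ᵥ f₁ = 0) (hfbar₁ : fbar₁ ⬝ᵥ fbar₁ = 0) (hff : f₁ ⬝ᵥ fbar₁ = 1)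
    (hAf₁ : A *ᵥ f₁ = 0)
    (B : Fin (n + 1) → ℂ) (hB : B = -fbar₁)
    (L : Matrix (Fin (n + 1)) (Fin (n + 1)) ℂ)
    (hL : IsUnit L)
    (hLnorm : Lᵀ * (A + vecMulVec fbar₁ fbar₁) * L = 1)
    (hLe : L *ᵥ Pi.single (Fin.last n) (1 : ℂ) = f₁)
    (S : Matrix (Fin (n + 1)) (Fin (n + 1)) ℂ)
    (hSsymm : Sᵀ = S)
    (hSA : S * A = A * S)
    (hSf₁ : S *ᵥ f₁ = f₁)
    (c : Fin (n + 1) → ℂ)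
    (hc : A *ᵥ c = (S - 1) *ᵥ B) :
    Pi.single (Fin.last n) (1 : ℂ) ᵥ* (L⁻¹ * S * L)
      = -((1 - vecMulVec (Pi.single (Fin.last n) (1 : ℂ)) (Pi.single (Fin.last n) (1 : ℂ)))
            *ᵥ (L⁻¹ *ᵥ c))
        + Pi.single (Fin.last n) (1 : ℂ) := by
  set e : Fin (n + 1) → ℂ := Pi.single (Fin.last n) (1 : ℂ)
  have hinv : L⁻¹ = Lᵀ * (A + vecMulVec fbar₁ fbar₁) := inv_eq_left_inv hLnorm
  have hMf : (A + vecMulVec fbar₁ fbar₁) *ᵥ f₁ = fbar₁ := by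
    simp [add_mulVec, hAf₁, vecMulVec_mulVec, dotProduct_comm fbar₁ f₁, hff]
  have hLf : Lᵀ *ᵥ fbar₁ = e := by
    rw [← hMf, ← hLe, mulVec_mulVec, mulVec_mulVec, hLnorm, one_mulVec]
  have heL : e ᵥ* L⁻¹ = fbar₁ := by
    rw [hinv, ← vecMul_vecMul, vecMul_transpose, hLe, ← mulVec_transpose, transpose_add, hA,
      transpose_vecMulVec, hMf]
  have hSf : S *ᵥ fbar₁ = fbar₁ - A *ᵥ c := by
    rw [hc, hB, sub_mulVec, one_mulVec, mulVec_neg]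
    abel
  have hLA : Lᵀ *ᵥ (A *ᵥ c) = (1 - vecMulVec e e) *ᵥ (L⁻¹ *ᵥ c) := by
    have hproj : vecMulVec e e *ᵥ (L⁻¹ *ᵥ c) = Lᵀ *ᵥ (vecMulVec fbar₁ fbar₁ *ᵥ c) := by
      simp only [vecMulVec_mulVec, dotProduct_mulVec, heL, op_smul_eq_smul, mulVec_smul, hLf]
    rw [sub_mulVec, one_mulVec, hproj, hinv, ← mulVec_mulVec, add_mulVec, mulVec_add,
      add_sub_cancel_right]
  rw [← vecMul_vecMul, ← vecMul_vecMul, heL, ← mulVec_transpose, ← mulVec_transpose, hSsymm,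
    hSf, mulVec_sub, hLf, hLA, sub_eq_neg_add]
end

section
/- (Orthogonality of the permutability matrix.) Let D₁, D₂ ∈ M_n(ℂ) be symmetric matrices with D₁D₂ = D₂D₁ and D₂² − D₁² = λ·I_n for some λ ∈ ℂ. Let P ∈ M_n(ℂ) satisfy PᵀP = I_n, and suppose D₂P − D₁ is invertible. Then M := (D₂ − D₁P)(D₂P − D₁)^{-1} satisfies MᵀM = I_n; moreover (D₂ − PD₁)(D₂P − D₁) = (PD₂ − D₁)(D₂ − D₁P). -/
open Matrix

/-- Orthogonality of the permutability matrix in the Bianchi Permutability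
Theorem: `M := (D₂ − D₁P)(D₂P − D₁)⁻¹` is complex orthogonal. -/
theorem permutability_matrix_orthogonal {n : ℕ}
    (D₁ D₂ : Matrix (Fin n) (Fin n) ℂ)
    (hD₁ : D₁ᵀ = D₁) (hD₂ : D₂ᵀ = D₂)
    (hcomm : D₁ * D₂ = D₂ * D₁)
    (l : ℂ) (hl : D₂ * D₂ - D₁ * D₁ = l • (1 : Matrix (Fin n) (Fin n) ℂ))
    (P : Matrix (Fin n) (Fin n) ℂ) (hP : Pᵀ * P = 1)
    (hinv : IsUnit (D₂ * P - D₁)) :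
    ((D₂ - D₁ * P) * (D₂ * P - D₁)⁻¹)ᵀ * ((D₂ - D₁ * P) * (D₂ * P - D₁)⁻¹) = 1 ∧
    (D₂ - P * D₁) * (D₂ * P - D₁) = (P * D₂ - D₁) * (D₂ - D₁ * P) := by
  have hsq : D₂ * D₂ = D₁ * D₁ + l • (1 : Matrix (Fin n) (Fin n) ℂ) := by
    rw [← hl]; abel
  constructor
  · have hgram : (D₂ - D₁ * P)ᵀ * (D₂ - D₁ * P) = (D₂ * P - D₁)ᵀ * (D₂ * P - D₁) := by
      have hconj : Pᵀ * (D₂ * D₂) * P = Pᵀ * (D₁ * D₁) * P + l • (1 : Matrix (Fin n) (Fin n) ℂ) := by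
        rw [hsq, mul_add, add_mul, mul_smul_comm, mul_one, smul_mul_assoc, hP]
      simp only [transpose_sub, transpose_mul, hD₁, hD₂]
      calc (D₂ - Pᵀ * D₁) * (D₂ - D₁ * P)
          = D₂ * D₂ - D₂ * D₁ * P - Pᵀ * (D₁ * D₂) + Pᵀ * (D₁ * D₁) * P := by noncomm_ring
        _ = Pᵀ * (D₂ * D₂) * P - Pᵀ * (D₂ * D₁) - D₁ * D₂ * P + D₁ * D₁ := by
          rw [hconj, hsq, hcomm]; abel
        _ = (Pᵀ * D₂ - D₁) * (D₂ * P - D₁) := by noncomm_ring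
    have hdet := (isUnit_iff_isUnit_det _).mp hinv
    rw [transpose_mul, Matrix.mul_assoc, ← Matrix.mul_assoc _ (D₂ - D₁ * P), hgram,
      Matrix.mul_assoc, mul_nonsing_inv _ hdet, Matrix.mul_one, ← transpose_mul,
      mul_nonsing_inv _ hdet, transpose_one]
  · calc (D₂ - P * D₁) * (D₂ * P - D₁)
        = D₂ * D₂ * P - D₂ * D₁ - P * (D₁ * D₂) * P + P * (D₁ * D₁) := by noncomm_ring
      _ = P * (D₂ * D₂) - P * (D₂ * D₁) * P - D₁ * D₂ + D₁ * D₁ * P := by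
        rw [hsq, hcomm, add_mul, mul_add, smul_mul_assoc, mul_smul_comm, one_mul, mul_one]; abel
      _ = (P * D₂ - D₁) * (D₂ - D₁ * P) := by noncomm_ring
end

section
/- (Well-definedness of the third iteration / M₃ configuration.) Let A' ∈ M_n(ℂ) and z₁, z₂, z₃ ∈ ℂ* be pairwise distinct, and let D₁, D₂, D₃ ∈ M_n(ℂ) be pairwise commuting invertible matrices with D_i² = z_i^{-1}·I_n − A' for i = 1, 2, 3 (so that D_i² − D_j² = (z_i^{-1} − z_j^{-1})·I_n are nonzero scalar matrices). Let R₁, R₂, R₄ ∈ M_n(ℂ) be such that D₁R₁ − D₂R₂, D₃R₄ − D₁R₁, D₂R₂ − D₃R₄ and Box := (D₂² − D₃²)D₁R₁ + (D₃² − D₁²)D₂R₂ + (D₁² − D₂²)D₃R₄ are invertible. Define Q₃ := (D₁D₂)^{-1}[(D₁² − D₂²)·D₁R₁·(D₁R₁ − D₂R₂)^{-1} − D₁²], Q₅ := (D₁D₃)^{-1}[(D₃² − D₁²)·D₁R₁·(D₃R₄ − D₁R₁)^{-1} − D₁²], Q₆ := (D₂D₃)^{-1}[(D₂² − D₃²)·D₂R₂·(D₂R₂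 − D₃R₄)^{-1} − D₂²], and assume D₂Q₃ − D₃Q₅ and D₃Q₆ − D₁Q₃ are invertible. Then D₁·[(D₂² − D₃²)·D₂Q₃·(D₂Q₃ − D₃Q₅)^{-1}·R₁ − D₂²·R₁] = D₂·[(D₃² − D₁²)·D₁Q₃·(D₃Q₆ − D₁Q₃)^{-1}·R₂ − D₁²·R₂]. -/
open Matrix

section

variable {m 𝕜 : Type*} [Fintype m] [DecidableEq m] [CommRing 𝕜]

/-- Clearing the invertible factors of a Bäcklund transform: left multiplication by `F` removes
the factor `F⁻¹` and cancels one copy of `E`. -/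
lemma mul_inv_mul_smul_sub_eq {E F : Matrix m m 𝕜} (hE : IsUnit E) (hF : IsUnit F)
    (s : 𝕜) (R W : Matrix m m 𝕜) :
    F * ((E * F)⁻¹ * (s • 1 * (E * R) * W - E * E)) = s • (R * W) - E := by
  rw [isUnit_iff_isUnit_det] at hE hF
  rw [Matrix.mul_inv_rev, mul_assoc, mul_nonsing_inv_cancel_left _ _ hF, mul_sub,
    nonsing_inv_mul_cancel_left _ _ hE, smul_mul_assoc, one_mul, smul_mul_assoc, mul_smul_comm,
    mul_assoc E, nonsing_inv_mul_cancel_left _ _ hE]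

/-- The quotient of one Bäcklund transform by the difference of two, in closed form. -/
lemma mul_inv_sub_mul_eq {X Y B P S : Matrix m m 𝕜} (hX : IsUnit X) (hY : IsUnit Y)
    (hB : IsUnit B) (hPS : IsUnit (P - S)) {s t : 𝕜} {R L : Matrix m m 𝕜}
    (hBeq : B = s • Y - t • X) (hP : P = s • (R * X⁻¹) - L) (hS : S = t • (R * Y⁻¹) - L) :
    P * (P - S)⁻¹ * R = (s • R - L * X) * B⁻¹ * Y := by
  rw [isUnit_iff_isUnit_det] at hX hY hB hPS
  have hPX : P * X = s • R - L * X := by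
    rw [hP, sub_mul, smul_mul_assoc, nonsing_inv_mul_cancel_right _ _ hX]
  have hdiff : (P - S) * X = R * Y⁻¹ * B := by
    rw [sub_mul, hPX, hS, hBeq, sub_mul, mul_sub, mul_smul_comm, mul_smul_comm,
      nonsing_inv_mul_cancel_right _ _ hY, smul_mul_assoc]
    abel
  have hR : R = (P - S) * (X * B⁻¹ * Y) := by
    rw [← mul_assoc, ← mul_assoc, hdiff, mul_nonsing_inv_cancel_right _ _ hB,
      nonsing_inv_mul_cancel_right _ _ hY]
  calc P * (P - S)⁻¹ * R
      = P * ((P - S)⁻¹ * ((P - S) * (X * B⁻¹ * Y))) := by rw [← hR, mul_assoc]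
    _ = P * X * B⁻¹ * Y := by
      rw [nonsing_inv_mul_cancel_left _ _ hPS]
      simp only [mul_assoc]
    _ = (s • R - L * X) * B⁻¹ * Y := by rw [hPX]

end

/-- Well-definedness of the third iteration of the Bäcklund transformation
(closing of the `M₃` Möbius configuration): the two algebraic expressions for
the final transform coincide. -/
theorem moebius_M3_configuration_closes {n : ℕ}
    (A' : Matrix (Fin n) (Fin n) ℂ)
    (z₁ z₂ z₃ : ℂ) (hz₁ : z₁ ≠ 0) (hz₂ : z₂ ≠ 0) (hz₃ : z₃ ≠ 0)
    (h₁₂ : z₁ ≠ z₂) (h₁₃ : z₁ ≠ z₃) (h₂₃ : z₂ ≠ z₃)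
    (D₁ D₂ D₃ : Matrix (Fin n) (Fin n) ℂ)
    (hD₁ : IsUnit D₁) (hD₂ : IsUnit D₂) (hD₃ : IsUnit D₃)
    (hc₁₂ : D₁ * D₂ = D₂ * D₁) (hc₁₃ : D₁ * D₃ = D₃ * D₁) (hc₂₃ : D₂ * D₃ = D₃ * D₂)
    (hD₁sq : D₁ * D₁ = z₁⁻¹ • (1 : Matrix (Fin n) (Fin n) ℂ) - A')
    (hD₂sq : D₂ * D₂ = z₂⁻¹ • (1 : Matrix (Fin n) (Fin n) ℂ) - A')
    (hD₃sq : D₃ * D₃ = z₃⁻¹ • (1 : Matrix (Fin n) (Fin n) ℂ) - A')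
    (R₁ R₂ R₄ : Matrix (Fin n) (Fin n) ℂ)
    (hu₁₂ : IsUnit (D₁ * R₁ - D₂ * R₂))
    (hu₃₁ : IsUnit (D₃ * R₄ - D₁ * R₁))
    (hu₂₃ : IsUnit (D₂ * R₂ - D₃ * R₄))
    (hbox : IsUnit ((D₂ * D₂ - D₃ * D₃) * (D₁ * R₁) + (D₃ * D₃ - D₁ * D₁) * (D₂ * R₂)
      + (D₁ * D₁ - D₂ * D₂) * (D₃ * R₄)))
    (Q₃ Q₅ Q₆ : Matrix (Fin n) (Fin n) ℂ)
    (hQ₃ : Q₃ = (D₁ * D₂)⁻¹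
      * ((D₁ * D₁ - D₂ * D₂) * (D₁ * R₁) * (D₁ * R₁ - D₂ * R₂)⁻¹ - D₁ * D₁))
    (hQ₅ : Q₅ = (D₁ * D₃)⁻¹
      * ((D₃ * D₃ - D₁ * D₁) * (D₁ * R₁) * (D₃ * R₄ - D₁ * R₁)⁻¹ - D₁ * D₁))
    (hQ₆ : Q₆ = (D₂ * D₃)⁻¹
      * ((D₂ * D₂ - D₃ * D₃) * (D₂ * R₂) * (D₂ * R₂ - D₃ * R₄)⁻¹ - D₂ * D₂))
    (hu₃₅ : IsUnit (D₂ * Q₃ - D₃ * Q₅))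
    (hu₆₃ : IsUnit (D₃ * Q₆ - D₁ * Q₃)) :
    D₁ * ((D₂ * D₂ - D₃ * D₃) * (D₂ * Q₃) * (D₂ * Q₃ - D₃ * Q₅)⁻¹ * R₁
        - (D₂ * D₂) * R₁)
      = D₂ * ((D₃ * D₃ - D₁ * D₁) * (D₁ * Q₃) * (D₃ * Q₆ - D₁ * Q₃)⁻¹ * R₂
        - (D₁ * D₁) * R₂) := by
  obtain ⟨s, hs⟩ : ∃ s : ℂ, D₁ * D₁ - D₂ * D₂ = s • 1 :=
    ⟨z₁⁻¹ - z₂⁻¹, by rw [hD₁sq, hD₂sq, sub_smul]; abel⟩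
  obtain ⟨t, ht⟩ : ∃ t : ℂ, D₃ * D₃ - D₁ * D₁ = t • 1 :=
    ⟨z₃⁻¹ - z₁⁻¹, by rw [hD₃sq, hD₁sq, sub_smul]; abel⟩
  have hr : D₂ * D₂ - D₃ * D₃ = (-s - t) • 1 := by
    rw [sub_smul, neg_smul, ← hs, ← ht]; abel
  rw [hs] at hQ₃ hbox
  rw [ht] at hQ₅ hbox
  rw [hr] at hQ₆ hbox
  rw [hr, ht]
  have hP₁ : D₂ * Q₃ = s • (R₁ * (D₁ * R₁ - D₂ * R₂)⁻¹) - D₁ := by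
    rw [hQ₃, mul_inv_mul_smul_sub_eq hD₁ hD₂]
  have hS₁ : D₃ * Q₅ = t • (R₁ * (D₃ * R₄ - D₁ * R₁)⁻¹) - D₁ := by
    rw [hQ₅, mul_inv_mul_smul_sub_eq hD₁ hD₃]
  have hS₂ : D₃ * Q₆ = (-s - t) • (R₂ * (D₂ * R₂ - D₃ * R₄)⁻¹) - D₂ := by
    rw [hQ₆, mul_inv_mul_smul_sub_eq hD₂ hD₃]
  have hsplit : s • 1 * (D₁ * R₁) * (D₁ * R₁ - D₂ * R₂)⁻¹ - D₁ * D₁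
      = s • 1 * (D₂ * R₂) * (D₁ * R₁ - D₂ * R₂)⁻¹ - D₂ * D₂ := by
    have h := mul_nonsing_inv _ ((isUnit_iff_isUnit_det _).1 hu₁₂)
    rw [← sub_eq_zero] at hs ⊢
    calc _ = s • ((D₁ * R₁ - D₂ * R₂) * (D₁ * R₁ - D₂ * R₂)⁻¹) - (D₁ * D₁ - D₂ * D₂) := by
          simp only [smul_mul_assoc, one_mul, sub_mul, smul_sub]
          abel
      _ = 0 := by rw [h, ← neg_eq_zero, neg_sub, hs]
  have hP₂ : D₁ * Q₃ = s • (R₂ * (D₁ * R₁ - D₂ * R₂)⁻¹) - D₂ := by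
    rw [hQ₃, hsplit, hc₁₂, mul_inv_mul_smul_sub_eq hD₂ hD₁]
  have hu₃₆ : IsUnit (D₁ * Q₃ - D₃ * Q₆) := by simpa using hu₆₃.neg
  set B := (-s - t) • 1 * (D₁ * R₁) + t • 1 * (D₂ * R₂) + s • 1 * (D₃ * R₄) with hB
  have key₁ := mul_inv_sub_mul_eq hu₁₂ hu₃₁ hbox hu₃₅
    (by rw [hB]; simp only [smul_mul_assoc, one_mul]; module) hP₁ hS₁
  have key₂ := mul_inv_sub_mul_eq hu₁₂ hu₂₃ hbox.neg hu₃₆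
    (by rw [hB]; simp only [smul_mul_assoc, one_mul]; module) hP₂ hS₂
  have hneg : ∀ M : Matrix (Fin n) (Fin n) ℂ, IsUnit M → (-M)⁻¹ = -M⁻¹ := fun M hM =>
    inv_eq_left_inv (by rw [neg_mul_neg, nonsing_inv_mul _ ((isUnit_iff_isUnit_det _).1 hM)])
  have hinv : (D₃ * Q₆ - D₁ * Q₃)⁻¹ = -(D₁ * Q₃ - D₃ * Q₆)⁻¹ := by
    rw [← hneg _ hu₃₆, neg_sub]
  rw [hneg _ hbox, mul_neg, neg_mul] at key₂
  set C := D₁ * D₁ * (D₂ * R₂) - D₂ * D₂ * (D₁ * R₁) with hC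
  have hC₁ : D₁ * (s • R₁ - D₁ * (D₁ * R₁ - D₂ * R₂)) = C := by
    have : s • (D₁ * R₁) = (D₁ * D₁ - D₂ * D₂) * (D₁ * R₁) := by
      rw [hs, smul_mul_assoc, one_mul]
    rw [mul_sub, mul_smul_comm, this, hC]
    noncomm_ring
  have hC₂ : D₂ * (s • R₂ - D₂ * (D₁ * R₁ - D₂ * R₂)) = C := by
    have : s • (D₂ * R₂) = (D₁ * D₁ - D₂ * D₂) * (D₂ * R₂) := by
      rw [hs, smul_mul_assoc, one_mul]
    rw [mul_sub, mul_smul_comm, this, hC]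
    noncomm_ring
  have hlhs : D₁ * ((-s - t) • 1 * (D₂ * Q₃) * (D₂ * Q₃ - D₃ * Q₅)⁻¹ * R₁ - D₂ * D₂ * R₁)
      = C * B⁻¹ * ((-s - t) • (D₃ * R₄ - D₁ * R₁)) - D₂ * D₂ * (D₁ * R₁) := by
    have hcomm : D₁ * (D₂ * D₂ * R₁) = D₂ * D₂ * (D₁ * R₁) := by
      simp only [← mul_assoc, hc₁₂]
      rw [mul_assoc D₂, hc₁₂, mul_assoc D₂ D₂ D₁]
    simp only [smul_mul_assoc, one_mul]
    rw [key₁, mul_sub, hcomm, mul_smul_comm, mul_smul_comm, ← hC₁]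
    simp only [mul_assoc]
  have hrhs : D₂ * (t • 1 * (D₁ * Q₃) * (D₃ * Q₆ - D₁ * Q₃)⁻¹ * R₂ - D₁ * D₁ * R₂)
      = C * B⁻¹ * (t • (D₂ * R₂ - D₃ * R₄)) - D₁ * D₁ * (D₂ * R₂) := by
    have hcomm : D₂ * (D₁ * D₁ * R₂) = D₁ * D₁ * (D₂ * R₂) := by
      simp only [← mul_assoc, ← hc₁₂]
      rw [mul_assoc D₁, ← hc₁₂, mul_assoc D₁ D₁ D₂]
    rw [hinv]
    simp only [smul_mul_assoc, one_mul, mul_neg, neg_mul]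
    rw [key₂, smul_neg, neg_neg, mul_sub, hcomm, mul_smul_comm, mul_smul_comm, ← hC₂]
    simp only [mul_assoc]
  rw [hlhs, hrhs, ← sub_eq_zero]
  calc _ = C - C * B⁻¹ * (t • (D₂ * R₂ - D₃ * R₄) - (-s - t) • (D₃ * R₄ - D₁ * R₁)) := by
        rw [mul_sub, hC]; abel
    _ = C - C * B⁻¹ * B := by
        congr 2
        rw [hB]; simp only [smul_mul_assoc, one_mul]; module
    _ = 0 := by
        rw [nonsing_inv_mul_cancel_right _ _ ((isUnit_iff_isUnit_det _).1 hbox), sub_self]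
end

section
/- Let A ∈ M_{n+1}(ℂ) be symmetric and invertible, T ∈ M_{n+1}(ℂ) symmetric and invertible with T² = A, z ∈ ℂ, and S ∈ M_{n+1}(ℂ) symmetric with S² = I_{n+1} − zA and ST = TS. For V = (v¹, …, vⁿ, 0)ᵀ ∈ ℂ^{n+1} with VᵀV + 1 ≠ 0, define X(V) := (2V + (VᵀV − 1)e_{n+1})/(VᵀV + 1) (the stereographic parametrization of the complex unit sphere) and x_z(V) := S·T^{-1}·X(V) (a point of the confocal quadric under the Ivory affinity). Then the partial derivatives ∂x_z/∂vᵏ = (2/(VᵀV + 1))·S·T^{-1}·(e_k + vᵏ(e_{n+1} − X(V))) satisfy the frame identity ((VᵀV + 1)²/4)·Σ_{k=1}^n (∂x_z/∂vᵏ)(∂x_z/∂vᵏ)ᵀ + x_z·x_zᵀ = A^{-1} − z·I_{n+1}. -/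
open Matrix

/-- Stereographic parametrization of the complex unit sphere in `ℂ^{n+1}`. -/
noncomputable def stereoX {n : ℕ} (W : Fin (n + 1) → ℂ) : Fin (n + 1) → ℂ :=
  (W ⬝ᵥ W + 1)⁻¹ • ((2 : ℂ) • W + (W ⬝ᵥ W - 1) • (Pi.single (Fin.last n) 1 : Fin (n + 1) → ℂ))

/-- The difference between the north pole and a stereographically parametrized point. -/
theorem single_last_sub_stereoX {n : ℕ} (V : Fin (n + 1) → ℂ) (hV : V ⬝ᵥ V + 1 ≠ 0) :
    (Pi.single (Fin.last n) 1 : Fin (n + 1) → ℂ) - stereoX V =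
      (2 / (V ⬝ᵥ V + 1)) • ((Pi.single (Fin.last n) 1 : Fin (n + 1) → ℂ) - V) := by
  ext i
  simp only [stereoX, Pi.sub_apply, Pi.smul_apply, Pi.add_apply, smul_eq_mul]
  field_simp
  ring

/-- The tangent frame of the stereographic parametrization, together with the position vector,
gives a resolution of the identity. -/
theorem sum_vecMulVec_stereoX_frame {n : ℕ} (V : Fin (n + 1) → ℂ)
    (hVlast : V (Fin.last n) = 0) (hV : V ⬝ᵥ V + 1 ≠ 0) :
    ∑ k : Fin n,
        vecMulVec
          ((Pi.single k.castSucc 1 : Fin (n + 1) → ℂ)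
            + V k.castSucc • ((Pi.single (Fin.last n) 1 : Fin (n + 1) → ℂ) - stereoX V))
          ((Pi.single k.castSucc 1 : Fin (n + 1) → ℂ)
            + V k.castSucc • ((Pi.single (Fin.last n) 1 : Fin (n + 1) → ℂ) - stereoX V))
      + vecMulVec (stereoX V) (stereoX V) = 1 := by
  set e : Fin (n + 1) → ℂ := Pi.single (Fin.last n) 1 with he
  set u := e - stereoX V with hu
  have hX : stereoX V = e - u := by rw [hu]; abel
  have hVu : ∀ i, V i = e i - (V ⬝ᵥ V + 1) / 2 * u i := by
    intro i
    have h := congrFun (single_last_sub_stereoX V hV) i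
    rw [← he, ← hu] at h
    simp only [Pi.smul_apply, Pi.sub_apply, smul_eq_mul] at h
    rw [h]
    field_simp
    ring
  have hsum : ∀ i j, ∑ k : Fin (n + 1),
      ((Pi.single k 1 : Fin (n + 1) → ℂ) i + V k * u i) *
        ((Pi.single k 1 : Fin (n + 1) → ℂ) j + V k * u j) =
      (1 : Matrix (Fin (n + 1)) (Fin (n + 1)) ℂ) i j + V i * u j + u i * V j
        + (V ⬝ᵥ V) * (u i * u j) := by
    intro i j
    simp only [add_mul, mul_add, Finset.sum_add_distrib, dotProduct, Finset.sum_mul,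
      Pi.single_apply, Matrix.one_apply, ite_mul, mul_ite, mul_one, one_mul, mul_zero, zero_mul,
      Finset.sum_ite_eq, Finset.mem_univ, if_true]
    have h : ∀ k, V k * u i * (V k * u j) = V k * V k * (u i * u j) := fun k => by ring
    simp only [h]
    ring
  ext i j
  have h := hsum i j
  rw [Fin.sum_univ_castSucc, hVlast, ← he] at h
  simp only [Matrix.add_apply, Matrix.sum_apply, vecMulVec_apply, Pi.add_apply, Pi.smul_apply,
    smul_eq_mul, hX, Pi.sub_apply]
  have hi := hVu i
  have hj := hVu j
  linear_combination h + u j * hi + u i * hj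

/-- Directional derivative of the stereographic parametrization along a coordinate axis of the
equatorial hyperplane. -/
theorem hasDerivAt_stereoX_add_smul_single {n : ℕ} (V : Fin (n + 1) → ℂ)
    (hV : V ⬝ᵥ V + 1 ≠ 0) (j : Fin (n + 1)) :
    HasDerivAt (fun t : ℂ => stereoX (V + t • (Pi.single j 1 : Fin (n + 1) → ℂ)))
      ((2 / (V ⬝ᵥ V + 1)) • ((Pi.single j 1 : Fin (n + 1) → ℂ)
        + V j • ((Pi.single (Fin.last n) 1 : Fin (n + 1) → ℂ) - stereoX V))) 0 := by
  have hq : ∀ t : ℂ, (V + t • (Pi.single j 1 : Fin (n + 1) → ℂ)) ⬝ᵥ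
      (V + t • (Pi.single j 1 : Fin (n + 1) → ℂ)) = V ⬝ᵥ V + 2 * V j * t + t ^ 2 := by
    intro t
    simp
    ring
  have hd : HasDerivAt (fun t : ℂ => V ⬝ᵥ V + 2 * V j * t + t ^ 2) (2 * V j) 0 := by
    refine ((((hasDerivAt_id' (0 : ℂ)).const_mul (2 * V j)).const_add (V ⬝ᵥ V)).add
      (hasDerivAt_pow 2 (0 : ℂ))).congr_deriv ?_
    simp
  rw [hasDerivAt_pi]
  intro i
  simp only [stereoX, hq, Pi.smul_apply, Pi.add_apply, Pi.sub_apply, smul_eq_mul]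
  have hl : HasDerivAt (fun t : ℂ => 2 * (V i + t * (Pi.single j 1 : Fin (n + 1) → ℂ) i))
      (2 * (Pi.single j 1 : Fin (n + 1) → ℂ) i) 0 := by
    simpa using (((hasDerivAt_id (0 : ℂ)).mul_const
      ((Pi.single j 1 : Fin (n + 1) → ℂ) i)).const_add (V i)).const_mul 2
  have hinv := (hd.add_const 1).fun_inv (by simpa using hV)
  refine (hinv.mul (hl.add ((hd.sub_const 1).mul_const
    ((Pi.single (Fin.last n) 1 : Fin (n + 1) → ℂ) i)))).congr_deriv ?_
  simp only [mul_zero, add_zero, zero_mul, ne_eq, OfNat.ofNat_ne_zero, not_false_eq_true, zero_pow,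
    Pi.add_apply]
  field_simp
  ring

/-- Conjugating a rank-one symmetric matrix. -/
theorem vecMulVec_mulVec_self {m R : Type*} [Fintype m] [CommSemiring R]
    (M : Matrix m m R) (v : m → R) :
    vecMulVec (M *ᵥ v) (M *ᵥ v) = M * vecMulVec v v * Mᵀ := by
  rw [mul_vecMulVec, vecMulVec_mul, vecMul_transpose]

/-- The frame identity
`((VᵀV+1)²/4)·Σ_k (∂x_z/∂vᵏ)(∂x_z/∂vᵏ)ᵀ + x_z x_zᵀ = A⁻¹ − z·I` for the Ivory
image `x_z = S·T⁻¹·X(V)` of the stereographically parametrized quadric with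
center, together with the formula for the partial derivatives `∂x_z/∂vᵏ`. -/
theorem confocal_frame_identity {n : ℕ}
    (A : Matrix (Fin (n + 1)) (Fin (n + 1)) ℂ)
    (hA : Aᵀ = A) (hAunit : IsUnit A)
    (T : Matrix (Fin (n + 1)) (Fin (n + 1)) ℂ)
    (hT : Tᵀ = T) (hTunit : IsUnit T) (hT2 : T * T = A)
    (z : ℂ)
    (S : Matrix (Fin (n + 1)) (Fin (n + 1)) ℂ)
    (hS : Sᵀ = S) (hS2 : S * S = 1 - z • A) (hST : S * T = T * S)
    (V : Fin (n + 1) → ℂ)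
    (hVlast : V (Fin.last n) = 0)
    (hV : V ⬝ᵥ V + 1 ≠ 0) :
    (∀ k : Fin n,
      HasDerivAt
        (fun t : ℂ => (S * T⁻¹) *ᵥ stereoX (V + t • (Pi.single k.castSucc 1 : Fin (n + 1) → ℂ)))
        ((2 / (V ⬝ᵥ V + 1)) •
          ((S * T⁻¹) *ᵥ
            ((Pi.single k.castSucc 1 : Fin (n + 1) → ℂ)
              + V k.castSucc • ((Pi.single (Fin.last n) 1 : Fin (n + 1) → ℂ) - stereoX V))))
        0) ∧
    ((V ⬝ᵥ V + 1) ^ 2 / 4) •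
        (∑ k : Fin n,
          vecMulVec
            ((2 / (V ⬝ᵥ V + 1)) •
              ((S * T⁻¹) *ᵥ
                ((Pi.single k.castSucc 1 : Fin (n + 1) → ℂ)
                  + V k.castSucc • ((Pi.single (Fin.last n) 1 : Fin (n + 1) → ℂ) - stereoX V))))
            ((2 / (V ⬝ᵥ V + 1)) •
              ((S * T⁻¹) *ᵥ
                ((Pi.single k.castSucc 1 : Fin (n + 1) → ℂ)
                  + V k.castSucc • ((Pi.single (Fin.last n) 1 : Fin (n + 1) → ℂ) - stereoX V)))))
      + vecMulVec ((S * T⁻¹) *ᵥ stereoX V) ((S * T⁻¹) *ᵥ stereoX V)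
      = A⁻¹ - z • (1 : Matrix (Fin (n + 1)) (Fin (n + 1)) ℂ) := by
  refine ⟨fun k => ?_, ?_⟩
  · have h := (Matrix.mulVecLin (S * T⁻¹)).toContinuousLinearMap.hasFDerivAt.comp_hasDerivAt
      (0 : ℂ) (hasDerivAt_stereoX_add_smul_single V hV k.castSucc)
    refine h.congr_deriv ?_
    exact mulVec_smul (S * T⁻¹) _ _
  · have hTdet : IsUnit T.det := (Matrix.isUnit_iff_isUnit_det T).mp hTunit
    have hAdet : IsUnit A.det := (Matrix.isUnit_iff_isUnit_det A).mp hAunit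
    have hconj : (S * T⁻¹) * (S * T⁻¹)ᵀ = A⁻¹ - z • 1 := by
      have hcomm : T⁻¹ * S = S * T⁻¹ := by
        rw [← Matrix.mul_nonsing_inv_cancel_right T (T⁻¹ * S) hTdet,
          Matrix.mul_assoc T⁻¹ S T, hST,
          Matrix.nonsing_inv_mul_cancel_left T S hTdet]
      calc (S * T⁻¹) * (S * T⁻¹)ᵀ = S * T⁻¹ * (T⁻¹ * S) := by
            rw [transpose_mul, transpose_nonsing_inv, hT, hS]
        _ = S * S * (T⁻¹ * T⁻¹) := by
            rw [Matrix.mul_assoc, hcomm, ← Matrix.mul_assoc T⁻¹ S, hcomm]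
            simp only [Matrix.mul_assoc]
        _ = (1 - z • A) * A⁻¹ := by rw [hS2, ← hT2, Matrix.mul_inv_rev]
        _ = A⁻¹ - z • 1 := by
            rw [Matrix.sub_mul, Matrix.one_mul, Matrix.smul_mul, Matrix.mul_nonsing_inv _ hAdet]
    have hc : (V ⬝ᵥ V + 1) ^ 2 / 4 * (2 / (V ⬝ᵥ V + 1) * (2 / (V ⬝ᵥ V + 1))) = 1 := by
      field_simp
      norm_num
    simp only [smul_vecMulVec, vecMulVec_smul, ← Finset.smul_sum, smul_smul, hc, one_smul,
      vecMulVec_mulVec_self]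
    rw [← Finset.sum_mul, ← Finset.mul_sum, ← Matrix.add_mul, ← Matrix.mul_add,
      sum_vecMulVec_stereoX_frame V hVlast hV, Matrix.mul_one, hconj]
end
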